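/- Let p ∈ (0,1) and ε > 0. Let F be a Lévy measure on ℝ^d with ∫ |z|²∧|z|^{p(1+ε)} F(dz) < ∞, and let y ∈ ℝ^d satisfy F({z : y^⊤z < −1}) = 0. Then the positive part of the function z ↦ p^{-1}(1+y^⊤z)^p − p^{-1} − y^⊤h(z) is F-integrable. Consequently, for any b ∈ ℝ^d and any symmetric positive semidefinite d×d matrix c, the quantity g^{(b,c,F)}(y) := y^⊤b + ((p−1)/2)·y^⊤cy + ∫ (p^{-1}(1+y^⊤z)^p − p^{-1} − y^⊤h(z)) F(dz) is well defined with values in [−∞,∞). -/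

import Mathlib

open MeasureTheory Filter Set
open scoped ENNReal NNReal Topology

noncomputable section

/-- The positive part of an extended real number, as an element of `ℝ≥0∞`. -/
def EReal.posPart (x : EReal) : ℝ≥0∞ := if x = ⊤ then ⊤ else ENNReal.ofReal x.toReal

/-- Integral of an `EReal`-valued function, defined as the difference of the lintegrals of
the positive and negative parts, with the conventions of `EReal` arithmetic
(in particular `∞ - ∞ = -∞`). -/
def eIntegral {α : Type*} [MeasurableSpace α] (F : Measure α) (f : α → EReal) : EReal :=
  ((∫⁻ z, (f z).posPart ∂F : ℝ≥0∞) : EReal) - ((∫⁻ z, (-(f z)).posPart ∂F : ℝ≥0∞) : EReal)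

/-- The dot product `y^⊤ z` on `ℝ^d`. -/
def dotp {d : ℕ} (y z : EuclideanSpace ℝ (Fin d)) : ℝ := ∑ i, y i * z i

/-- The quadratic form `y^⊤ c y`. -/
def quadf {d : ℕ} (c : Matrix (Fin d) (Fin d) ℝ) (y : EuclideanSpace ℝ (Fin d)) : ℝ :=
  ∑ i, ∑ j, c i j * y i * y j

/-- The (Frobenius) norm `|c|` of a matrix. -/
def matNorm {d : ℕ} (c : Matrix (Fin d) (Fin d) ℝ) : ℝ :=
  Real.sqrt (∑ i, ∑ j, (c i j) ^ 2)

/-- A Lévy measure on `ℝ^d`: a (Borel) measure with `F({0}) = 0` and `∫ |z|² ∧ 1 F(dz) < ∞`. -/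
def IsLevyMeasure {d : ℕ} (F : Measure (EuclideanSpace ℝ (Fin d))) : Prop :=
  F {0} = 0 ∧ ∫⁻ z, ENNReal.ofReal (min (‖z‖ ^ 2) 1) ∂F < ⊤

/-- A truncation function: bounded, measurable, equal to the identity near the origin. -/
structure IsTruncation {d : ℕ}
    (h : EuclideanSpace ℝ (Fin d) → EuclideanSpace ℝ (Fin d)) : Prop where
  measurable : Measurable h
  bounded : ∃ M : ℝ, ∀ z, ‖h z‖ ≤ M
  eq_id_near_zero : ∃ δ : ℝ, 0 < δ ∧ ∀ z, ‖z‖ < δ → h z = z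

/-- The integrand `I_y(z)`, as an extended real number:
`log(1+y^⊤z) - y^⊤h(z)` if `p = 0`, and `p⁻¹(1+y^⊤z)^p - p⁻¹ - y^⊤h(z)` if `p ≠ 0`,
with the conventions `log 0 = -∞` and `0^p = +∞` for `p < 0` (so that the integrand
is `-∞` on `{1 + y^⊤z ≤ 0}` when `p ≤ 0`). -/
def Ifun {d : ℕ} (p : ℝ) (h : EuclideanSpace ℝ (Fin d) → EuclideanSpace ℝ (Fin d))
    (y z : EuclideanSpace ℝ (Fin d)) : EReal :=
  if 0 < 1 + dotp y z then
    (if p = 0 then ((Real.log (1 + dotp y z) - dotp y (h z) : ℝ) : EReal)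
      else ((p⁻¹ * (1 + dotp y z) ^ p - p⁻¹ - dotp y (h z) : ℝ) : EReal))
  else if p ≤ 0 then (⊥ : EReal)
  else ((p⁻¹ * (1 + dotp y z) ^ p - p⁻¹ - dotp y (h z) : ℝ) : EReal)

/-- The function `g^{(b,c,F)}(y) = y^⊤b + ((p-1)/2)·y^⊤cy + ∫ I_y(z) F(dz)`. -/
def gfun {d : ℕ} (p : ℝ) (h : EuclideanSpace ℝ (Fin d) → EuclideanSpace ℝ (Fin d))
    (b : EuclideanSpace ℝ (Fin d)) (c : Matrix (Fin d) (Fin d) ℝ)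
    (F : Measure (EuclideanSpace ℝ (Fin d))) (y : EuclideanSpace ℝ (Fin d)) : EReal :=
  ((dotp y b + (p - 1) / 2 * quadf c y : ℝ) : EReal) + eIntegral F (fun z => Ifun p h y z)

/-- Triples `θ = (b, c, F)`. -/
abbrev Triple (d : ℕ) :=
  EuclideanSpace ℝ (Fin d) × Matrix (Fin d) (Fin d) ℝ × Measure (EuclideanSpace ℝ (Fin d))

/-- `g^θ(y)` for a triple `θ = (b,c,F)`. -/
def gTheta {d : ℕ} (p : ℝ) (h : EuclideanSpace ℝ (Fin d) → EuclideanSpace ℝ (Fin d))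
    (θ : Triple d) (y : EuclideanSpace ℝ (Fin d)) : EReal :=
  gfun p h θ.1 θ.2.1 θ.2.2 y

/-- The integrand appearing in the definition of the constant `K`, depending on `p`
(and an extra parameter `ε > 0` when `p ∈ (0,1)`). -/
def Kintegrand {d : ℕ} (p ε : ℝ) (z : EuclideanSpace ℝ (Fin d)) : ℝ :=
  if p = 0 then min (‖z‖ ^ 2) (Real.log (1 + ‖z‖))
  else if 0 < p then min (‖z‖ ^ 2) (‖z‖ ^ (p * (1 + ε)))
  else min (‖z‖ ^ 2) 1

/-- The natural constraints `C⁰ = ∩_{F ∈ L_Θ} {y : F({z : y^⊤z < -1}) = 0}`. -/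
def natC {d : ℕ} (Θ : Set (Triple d)) : Set (EuclideanSpace ℝ (Fin d)) :=
  {y | ∀ θ ∈ Θ, θ.2.2 {z | dotp y z < -1} = 0}

/-- The sets `C⁰ₙ = ∩_{F ∈ L_Θ} {y : F({z : y^⊤z < -1 + 1/n}) = 0}`. -/
def natCn {d : ℕ} (Θ : Set (Triple d)) (n : ℕ) : Set (EuclideanSpace ℝ (Fin d)) :=
  {y | ∀ θ ∈ Θ, θ.2.2 {z | dotp y z < -1 + 1 / (n : ℝ)} = 0}

/-- The finite measure `|z|² ∧ 1 · F`. -/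
def sq1Measure {d : ℕ} (F : Measure (EuclideanSpace ℝ (Fin d))) :
    Measure (EuclideanSpace ℝ (Fin d)) :=
  F.withDensity (fun z => ENNReal.ofReal (min (‖z‖ ^ 2) 1))

/-- The standing assumptions of the paper: `p = 0` or `p ∈ (-∞,0) ∪ (0,1)`, `ε > 0`,
`h` is a truncation function, `Θ` is a nonempty convex set of Lévy triplets with `K < ∞`,
`C` is closed, convex and contains `0`, and `C ∩ C⁰` is compact. -/
structure Standing {d : ℕ} (p ε : ℝ)
    (h : EuclideanSpace ℝ (Fin d) → EuclideanSpace ℝ (Fin d))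
    (Θ : Set (Triple d)) (C : Set (EuclideanSpace ℝ (Fin d))) : Prop where
  p_range : p = 0 ∨ p < 0 ∨ (0 < p ∧ p < 1)
  eps_pos : 0 < ε
  trunc : IsTruncation h
  Theta_nonempty : Θ.Nonempty
  Theta_psd : ∀ θ ∈ Θ, (θ.2.1).PosSemidef
  Theta_levy : ∀ θ ∈ Θ, IsLevyMeasure θ.2.2
  Theta_convex : ∀ θ₁ ∈ Θ, ∀ θ₂ ∈ Θ, ∀ t : ℝ, 0 ≤ t → t ≤ 1 →
    (t • θ₁.1 + (1 - t) • θ₂.1, t • θ₁.2.1 + (1 - t) • θ₂.2.1,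
      ENNReal.ofReal t • θ₁.2.2 + ENNReal.ofReal (1 - t) • θ₂.2.2) ∈ Θ
  K_finite : ∃ K : ℝ, ∀ θ ∈ Θ,
    (∫⁻ z, ENNReal.ofReal (Kintegrand p ε z) ∂θ.2.2) ≠ ⊤ ∧
    ‖θ.1‖ + matNorm θ.2.1 + (∫⁻ z, ENNReal.ofReal (Kintegrand p ε z) ∂θ.2.2).toReal ≤ K
  C_closed : IsClosed C
  C_convex : Convex ℝ C
  C_zero : (0 : EuclideanSpace ℝ (Fin d)) ∈ C
  CC0_compact : IsCompact (C ∩ natC Θ)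

lemma EReal.posPart_coe (x : ℝ) : EReal.posPart (x : EReal) = ENNReal.ofReal x := by
  simp [EReal.posPart]

/-- An extended integral is `< ∞` as soon as the positive part is integrable. -/
lemma eIntegral_lt_top {α : Type*} [MeasurableSpace α] {F : Measure α} {f : α → EReal}
    (hf : ∫⁻ z, (f z).posPart ∂F < ⊤) : eIntegral F f < ⊤ := by
  have hle : eIntegral F f ≤ ((∫⁻ z, (f z).posPart ∂F : ℝ≥0∞) : EReal) := by
    simpa [eIntegral] using EReal.sub_le_sub le_rfl
      (EReal.coe_ennreal_nonneg (∫⁻ z, (-(f z)).posPart ∂F))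
  refine hle.trans_lt (lt_top_iff_ne_top.mpr ?_)
  simpa using hf.ne

lemma dotp_eq_inner {d : ℕ} (y z : EuclideanSpace ℝ (Fin d)) : dotp y z = inner ℝ y z := by
  simp [dotp, PiLp.inner_apply, mul_comm]

lemma abs_dotp_le {d : ℕ} (y z : EuclideanSpace ℝ (Fin d)) : |dotp y z| ≤ ‖y‖ * ‖z‖ := by
  rw [dotp_eq_inner]
  exact abs_real_inner_le_norm y z

/-- For `p > 0` the integrand is real-valued. -/
lemma Ifun_of_pos {d : ℕ} {p : ℝ} (hp : 0 < p)
    (h : EuclideanSpace ℝ (Fin d) → EuclideanSpace ℝ (Fin d)) (y z : EuclideanSpace ℝ (Fin d)) :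
    Ifun p h y z = ((p⁻¹ * (1 + dotp y z) ^ p - p⁻¹ - dotp y (h z) : ℝ) : EReal) := by
  simp [Ifun, hp.ne', hp.not_ge]

lemma inv_mul_one_add_rpow_sub_le {p s : ℝ} (hp0 : 0 < p) (hp1 : p ≤ 1) (hs : -1 ≤ s) :
    p⁻¹ * (1 + s) ^ p - p⁻¹ ≤ s := by
  have hB := mul_le_mul_of_nonneg_left (rpow_one_add_le_one_add_mul_self hs hp0.le hp1)
    (inv_nonneg.mpr hp0.le)
  have : p⁻¹ * (1 + p * s) = p⁻¹ + s := by field_simp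
  linarith

lemma one_add_mul_rpow_le {p a r : ℝ} (hp : 0 ≤ p) (ha : 0 ≤ a) (hr : 0 ≤ r) :
    (1 + a * r) ^ p ≤ (1 + a) ^ p * max 1 (r ^ p) := by
  rcases le_total r 1 with h1 | h1
  · calc (1 + a * r) ^ p ≤ (1 + a) ^ p :=
          Real.rpow_le_rpow (by positivity) (by nlinarith) hp
      _ ≤ (1 + a) ^ p * max 1 (r ^ p) :=
          le_mul_of_one_le_right (by positivity) (le_max_left _ _)
  · calc (1 + a * r) ^ p ≤ ((1 + a) * r) ^ p :=
          Real.rpow_le_rpow (by positivity) (by nlinarith) hp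
      _ = (1 + a) ^ p * r ^ p := Real.mul_rpow (by positivity) hr
      _ ≤ (1 + a) ^ p * max 1 (r ^ p) := by
          gcongr
          exact le_max_right _ _

/-- Away from the origin, `1 ∨ r^p` is dominated by the two moment functions. -/
lemma sq_mul_max_one_rpow_le {p q η r : ℝ} (hp0 : 0 ≤ p) (hp1 : p ≤ 1) (hpq : p ≤ q)
    (hη : 0 < η) (hη1 : η ≤ 1) (hr : η ≤ r) :
    η ^ 2 * max 1 (r ^ p) ≤ min (r ^ 2) 1 + min (r ^ 2) (r ^ q) := by
  have hr0 : 0 < r := hη.trans_le hr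
  have hη2 : η ^ 2 ≤ 1 := pow_le_one₀ hη.le hη1
  rcases le_total 1 r with h1 | h1
  · have h2 : r ^ p ≤ r ^ 2 := by
      rw [← Real.rpow_two]
      exact Real.rpow_le_rpow_of_exponent_le h1 (by linarith)
    have hm : r ^ p ≤ min (r ^ 2) (r ^ q) :=
      le_min h2 (Real.rpow_le_rpow_of_exponent_le h1 hpq)
    have h3 : min (r ^ 2) 1 = 1 := min_eq_right (one_le_pow₀ h1)
    have h4 : max 1 (r ^ p) ≤ 1 + r ^ p :=
      max_le (by linarith [Real.rpow_pos_of_pos hr0 p]) (by linarith)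
    have h5 : η ^ 2 * max 1 (r ^ p) ≤ max 1 (r ^ p) :=
      mul_le_of_le_one_left (zero_le_one.trans (le_max_left _ _)) hη2
    linarith
  · have h2 : η ^ 2 ≤ r ^ 2 := pow_le_pow_left₀ hη.le hr 2
    have h3 : 0 ≤ min (r ^ 2) (r ^ q) := le_min (by positivity) (by positivity)
    rw [max_eq_left (Real.rpow_le_one hr0.le h1 hp0), mul_one]
    linarith [le_min h2 hη2]

/-- The integrand is dominated by a multiple of `|z|² ∧ 1 + |z|² ∧ |z|^q`. -/
lemma exists_integrand_le {d : ℕ} {p q : ℝ} (hp0 : 0 < p) (hp1 : p ≤ 1) (hpq : p ≤ q)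
    {h : EuclideanSpace ℝ (Fin d) → EuclideanSpace ℝ (Fin d)} (hh : IsTruncation h)
    (y : EuclideanSpace ℝ (Fin d)) :
    ∃ K : ℝ, 0 ≤ K ∧ ∀ z, -1 ≤ dotp y z →
      p⁻¹ * (1 + dotp y z) ^ p - p⁻¹ - dotp y (h z) ≤
        K * (min (‖z‖ ^ 2) 1 + min (‖z‖ ^ 2) (‖z‖ ^ q)) := by
  obtain ⟨M, hM⟩ := hh.bounded
  obtain ⟨δ, hδ, hid⟩ := hh.eq_id_near_zero
  have hM0 : 0 ≤ M := (norm_nonneg _).trans (hM 0)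
  set η := min δ 1
  have hη : 0 < η := lt_min hδ one_pos
  set A := p⁻¹ * (1 + ‖y‖) ^ p + ‖y‖ * M
  have hA : 0 ≤ A := by positivity
  refine ⟨A / η ^ 2, by positivity, fun z hz ↦ ?_⟩
  rcases lt_or_ge ‖z‖ η with hzη | hzη
  · rw [hid z (hzη.trans_le (min_le_left _ _))]
    have h1 : 0 ≤ A / η ^ 2 * (min (‖z‖ ^ 2) 1 + min (‖z‖ ^ 2) (‖z‖ ^ q)) := by positivity
    linarith [inv_mul_one_add_rpow_sub_le hp0 hp1 hz]
  · have h1 : (1 + dotp y z) ^ p ≤ (1 + ‖y‖) ^ p * max 1 (‖z‖ ^ p) :=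
      (Real.rpow_le_rpow (by linarith)
        (by linarith [(le_abs_self _).trans (abs_dotp_le y z)]) hp0.le).trans
        (one_add_mul_rpow_le hp0.le (norm_nonneg y) (norm_nonneg z))
    have h2 : -dotp y (h z) ≤ ‖y‖ * M * max 1 (‖z‖ ^ p) :=
      ((neg_le_abs _).trans (abs_dotp_le y (h z))).trans
        ((mul_le_mul_of_nonneg_left (hM z) (norm_nonneg y)).trans
          (le_mul_of_one_le_right (by positivity) (le_max_left _ _)))
    calc p⁻¹ * (1 + dotp y z) ^ p - p⁻¹ - dotp y (h z)
        ≤ A * max 1 (‖z‖ ^ p) := by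
          have h3 := mul_le_mul_of_nonneg_left h1 (inv_nonneg.mpr hp0.le)
          have h4 := inv_pos.mpr hp0
          simp only [A]
          linarith
      _ = A / η ^ 2 * (η ^ 2 * max 1 (‖z‖ ^ p)) := by field_simp
      _ ≤ _ := by
          gcongr
          exact sq_mul_max_one_rpow_le hp0.le hp1 hpq hη (min_le_right _ _) hzη

/-- For `p ∈ (0,1)` and `ε > 0`, if `F` is a Lévy measure with
`∫ |z|² ∧ |z|^{p(1+ε)} F(dz) < ∞` and `y` satisfies `F({z : y^⊤z < -1}) = 0`, then the
positive part of `z ↦ p⁻¹(1+y^⊤z)^p - p⁻¹ - y^⊤h(z)` is `F`-integrable, and for every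
drift `b` and symmetric positive semidefinite matrix `c` the quantity `g^{(b,c,F)}(y)` is
well defined with values in `[-∞, ∞)`. -/
theorem stmt1 {d : ℕ} (hd : 1 ≤ d) (p ε : ℝ) (hp0 : 0 < p) (hp1 : p < 1) (hε : 0 < ε)
    (h : EuclideanSpace ℝ (Fin d) → EuclideanSpace ℝ (Fin d)) (hh : IsTruncation h)
    (F : Measure (EuclideanSpace ℝ (Fin d))) (hF : IsLevyMeasure F)
    (hFint : ∫⁻ z, ENNReal.ofReal (min (‖z‖ ^ 2) (‖z‖ ^ (p * (1 + ε)))) ∂F < ⊤)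
    (y : EuclideanSpace ℝ (Fin d)) (hy : F {z | dotp y z < -1} = 0) :
    (∫⁻ z, (Ifun p h y z).posPart ∂F) < ⊤ ∧
    ∀ (b : EuclideanSpace ℝ (Fin d)) (c : Matrix (Fin d) (Fin d) ℝ),
      c.PosSemidef → gfun p h b c F y < (⊤ : EReal) := by
  have hpos : ∫⁻ z, (Ifun p h y z).posPart ∂F < ⊤ := by
    obtain ⟨K, hK, hle⟩ := exists_integrand_le hp0 hp1.le
      (le_mul_of_one_le_right hp0.le (by linarith : 1 ≤ 1 + ε)) hh y
    have hae : ∀ᵐ z ∂F, -1 ≤ dotp y z := by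
      simpa [ae_iff] using hy
    calc ∫⁻ z, (Ifun p h y z).posPart ∂F
        ≤ ∫⁻ z, ENNReal.ofReal K * (ENNReal.ofReal (min (‖z‖ ^ 2) 1) +
            ENNReal.ofReal (min (‖z‖ ^ 2) (‖z‖ ^ (p * (1 + ε))))) ∂F := by
          refine lintegral_mono_ae (hae.mono fun z hz ↦ ?_)
          rw [Ifun_of_pos hp0, EReal.posPart_coe,
            ← ENNReal.ofReal_add (by positivity) (by positivity), ← ENNReal.ofReal_mul hK]
          exact ENNReal.ofReal_le_ofReal (hle z hz)
      _ = ENNReal.ofReal K * (∫⁻ z, ENNReal.ofReal (min (‖z‖ ^ 2) 1) ∂F +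
            ∫⁻ z, ENNReal.ofReal (min (‖z‖ ^ 2) (‖z‖ ^ (p * (1 + ε)))) ∂F) := by
          rw [lintegral_const_mul _ (by fun_prop), lintegral_add_left (by fun_prop)]
      _ < ⊤ := ENNReal.mul_lt_top ENNReal.ofReal_lt_top (ENNReal.add_lt_top.mpr ⟨hF.2, hFint⟩)
  exact ⟨hpos, fun b c _ ↦ EReal.add_lt_top (EReal.coe_ne_top _) (eIntegral_lt_top hpos).ne⟩
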